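/- arXiv:0908.3704 — 2 statements merged into one kernel-verified Lean document; each statement's English description precedes it below -/
import Mathlib

section
/- Let α > 2, C > 0, let u₀ : S¹ → ℝ be continuous and nonnegative, and let U : ℝ² → ℝ be measurable with 0 ≤ U(x) ≤ C(1 + ‖x‖²)^{−α/2} for all x, and U(x) = u₀(x/‖x‖)·‖x‖^{−α}·(1 + o(1)) as ‖x‖ → ∞. Then lim_{r→0⁺} r^{2/α} ∫_{ℝ²} arctan(U(x)/r) dx = (π / (4 cos(π/α))) · ∫_{S¹} u₀(θ)^{2/α} dσ(θ). (This is the asymptotics of the trace Tr arctan(s⁻¹ p U p) underlying Corollary 3.2(i), with the constant producing the factor 1/(2cos(π/(m−1))) relating ξ(E) and ξ(−E).) -/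
open MeasureTheory Metric Filter
open scoped Topology

/-- The Euclidean plane. -/
noncomputable abbrev Plane := EuclideanSpace ℝ (Fin 2)

/-- The canonical (arclength) surface measure on the unit circle `S¹ ⊂ ℝ²`,
with total mass `2π`. -/
noncomputable def circleMeasure : Measure (sphere (0 : Plane) 1) :=
  (volume : Measure Plane).toSphere

section AsymptoticHelpers

open Set Real

theorem integral_rpow_mul_one_sub_rpow {s : ℝ} (hs0 : 0 < s) (hs1 : s < 1) :
    ∫ x in Ioo (0 : ℝ) 1, x ^ (s - 1) * (1 - x) ^ (-s) = π / sin (π * s) := by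
  have h := Complex.Gamma_mul_Gamma_eq_betaIntegral (s := (s : ℂ)) (t := ((1 - s : ℝ) : ℂ))
    (by simpa) (by simpa)
  rw [← Complex.ofReal_add, Complex.Gamma_ofReal, Complex.Gamma_ofReal, Complex.Gamma_ofReal,
    ← Complex.ofReal_mul, Real.Gamma_mul_Gamma_one_sub, add_sub_cancel, Real.Gamma_one,
    Complex.ofReal_one, one_mul, Complex.betaIntegral,
    intervalIntegral.integral_of_le zero_le_one] at h
  rw [← integral_Ioc_eq_integral_Ioo, ← Complex.ofReal_inj, h, ← integral_complex_ofReal]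
  refine setIntegral_congr_fun measurableSet_Ioc fun x hx ↦ ?_
  have h1 : (0 : ℝ) ≤ 1 - x := by linarith [hx.2]
  simp only [Complex.ofReal_mul]
  rw [Complex.ofReal_cpow hx.1.le, Complex.ofReal_cpow h1]
  push_cast
  congr 2
  ring

theorem image_div_one_add_Ioi : (fun w : ℝ ↦ w / (1 + w)) '' Ioi 0 = Ioo 0 1 := by
  ext x
  constructor
  · rintro ⟨w, hw, rfl⟩
    have hw : 0 < w := hw
    exact ⟨by positivity, by rw [div_lt_one (by positivity)]; linarith⟩
  · rintro ⟨h0, h1⟩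
    have : 0 < 1 - x := by linarith
    refine ⟨x / (1 - x), by simp only [mem_Ioi]; positivity, ?_⟩
    have h2 : 1 - x + x ≠ 0 := by simp
    field_simp
    ring

theorem integral_rpow_div_one_add {s : ℝ} (hs0 : 0 < s) (hs1 : s < 1) :
    ∫ w in Ioi (0 : ℝ), w ^ (s - 1) / (1 + w) = π / sin (π * s) := by
  rw [← integral_rpow_mul_one_sub_rpow hs0 hs1, ← image_div_one_add_Ioi,
    integral_image_eq_integral_abs_deriv_smul (f' := fun w ↦ 1 / (1 + w) ^ 2) measurableSet_Ioi]
  · refine setIntegral_congr_fun measurableSet_Ioi fun w (hw : 0 < w) ↦ ?_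
    have h1 : (0 : ℝ) < 1 + w := by linarith
    have h2 : 1 - w / (1 + w) = (1 + w)⁻¹ := by field_simp; ring
    have h3 : (1 + w) ^ (s - 1) = (1 + w) ^ s / (1 + w) := rpow_sub_one h1.ne' s
    simp only [smul_eq_mul]
    rw [h2, div_rpow hw.le h1.le, inv_rpow h1.le, rpow_neg h1.le, inv_inv, h3,
      abs_of_pos (by positivity)]
    have := rpow_pos_of_pos h1 s
    field_simp
  · intro w (hw : 0 < w)
    have h1 : 1 + w ≠ 0 := by positivity
    convert! ((hasDerivAt_id w).div ((hasDerivAt_id w).const_add 1) h1).hasDerivWithinAt using 1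
    simp
  · intro a (ha : 0 < a) b (hb : 0 < b) hab
    simp only at hab
    rw [div_eq_div_iff (by positivity) (by positivity)] at hab
    linarith

theorem integral_rpow_div_one_add_rpow {p q : ℝ} (hq : 0 < q) (hqp : q < p) :
    ∫ x in Ioi (0 : ℝ), x ^ (q - 1) / (1 + x ^ p) = π / (p * sin (π * (q / p))) := by
  have hp : 0 < p := hq.trans hqp
  have h := integral_comp_rpow_Ioi_of_pos (g := fun w : ℝ ↦ w ^ (q / p - 1) / (1 + w)) hp
  rw [integral_rpow_div_one_add (by positivity) ((div_lt_one hp).2 hqp)] at h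
  rw [mul_comm p, ← div_div, ← h, eq_div_iff hp.ne', mul_comm, ← integral_const_mul]
  refine setIntegral_congr_fun measurableSet_Ioi fun x (hx : 0 < x) ↦ ?_
  simp only [smul_eq_mul]
  have h1 : x ^ (q - 1) = x ^ (p - 1) * x ^ (p * (q / p - 1)) := by
    rw [← rpow_add hx]
    congr 1
    field_simp
    ring
  rw [← rpow_mul hx.le, h1]
  ring

theorem integrableOn_rpow_div_one_add_rpow {p q : ℝ} (hq : 0 < q) (hqp : q < p) :
    IntegrableOn (fun x : ℝ ↦ x ^ (q - 1) / (1 + x ^ p)) (Ioi 0) := by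
  have hp : 0 < p := hq.trans hqp
  refine Integrable.of_integral_ne_zero ?_
  rw [integral_rpow_div_one_add_rpow hq hqp]
  have : 0 < sin (π * (q / p)) := sin_pos_of_pos_of_lt_pi (by positivity)
    (mul_lt_of_lt_one_right pi_pos ((div_lt_one hp).2 hqp))
  positivity

theorem arctan_le_self {t : ℝ} (ht : 0 ≤ t) : arctan t ≤ t := by
  have := le_tan (arctan_nonneg.2 ht) (arctan_lt_pi_div_two t)
  rwa [tan_arctan] at this

theorem arctan_inv_le {t : ℝ} (ht : 0 < t) : arctan t⁻¹ ≤ 4 / (1 + t) := by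
  rw [le_div_iff₀ (by positivity)]
  have h0 : 0 ≤ arctan t⁻¹ := arctan_nonneg.2 (by positivity)
  have h1 : arctan t⁻¹ * t ≤ 1 := by
    rw [← le_div_iff₀ ht, one_div]
    exact arctan_le_self (by positivity)
  linarith [arctan_lt_pi_div_two t⁻¹, pi_lt_four]

theorem integrableOn_mul_arctan_rpow_neg {α : ℝ} (hα : 2 < α) :
    IntegrableOn (fun x : ℝ ↦ x * arctan (x ^ (-α))) (Ioi 0) := by
  refine ((integrableOn_rpow_div_one_add_rpow zero_lt_two hα).const_mul 4).mono'
    (by fun_prop) ?_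
  refine ae_restrict_of_forall_mem measurableSet_Ioi fun x (hx : 0 < x) ↦ ?_
  have hxa := rpow_pos_of_pos hx α
  have h0 : 0 ≤ arctan (x ^ (-α)) := arctan_nonneg.2 (by positivity)
  rw [norm_of_nonneg (by positivity), rpow_neg hx.le]
  have h1 : x ^ ((2 : ℝ) - 1) = x := by norm_num
  rw [h1]
  calc x * arctan (x ^ α)⁻¹ ≤ x * (4 / (1 + x ^ α)) := by gcongr; exact arctan_inv_le hxa
    _ = _ := by ring

theorem hasDerivAt_sq_mul_arctan_rpow_neg (α : ℝ) {x : ℝ} (hx : 0 < x) :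
    HasDerivAt (fun x ↦ x ^ 2 / 2 * arctan (x ^ (-α)))
      (x * arctan (x ^ (-α)) - α / 2 * (x ^ (α + 2 - 1) / (1 + x ^ (2 * α)))) x := by
  have h1 := (hasDerivAt_rpow_const (p := -α) (Or.inl hx.ne')).arctan
  have h2 := ((hasDerivAt_pow 2 x).div_const 2).mul h1
  convert! h2 using 1
  have hxa := rpow_pos_of_pos hx α
  have e1 : x ^ (α + 2 - 1) = x ^ α * x := by
    rw [show α + 2 - 1 = α + 1 by ring, rpow_add_one hx.ne']
  have e2 : x ^ (2 * α) = (x ^ α) ^ 2 := by rw [mul_comm, rpow_mul hx.le, rpow_two]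
  rw [e1, e2, rpow_sub_one hx.ne', rpow_neg hx.le]
  field_simp
  ring

theorem integral_mul_arctan_rpow_neg {α : ℝ} (hα : 2 < α) :
    ∫ x in Ioi (0 : ℝ), x * arctan (x ^ (-α)) = π / (4 * cos (π / α)) := by
  have hα0 : 0 < α := by linarith
  set F : ℝ → ℝ := fun x ↦ x ^ 2 / 2 * arctan (x ^ (-α)) with hF
  have hF_int := integrableOn_mul_arctan_rpow_neg hα
  have hG_int := (integrableOn_rpow_div_one_add_rpow (p := 2 * α) (q := α + 2)
    (by linarith) (by linarith)).const_mul (α / 2)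
  have hcont : ContinuousWithinAt F (Ici 0) 0 := by
    have hb : Tendsto (fun x : ℝ ↦ x ^ 2 / 2 * (π / 2)) (𝓝[Ici 0] 0) (𝓝 0) := by
      have : Continuous (fun x : ℝ ↦ x ^ 2 / 2 * (π / 2)) := by fun_prop
      simpa using (this.tendsto 0).mono_left nhdsWithin_le_nhds
    have hF0 : F 0 = 0 := by simp [hF]
    rw [ContinuousWithinAt, hF0]
    refine squeeze_zero_norm (fun x ↦ ?_) hb
    rw [hF, norm_mul, norm_of_nonneg (by positivity : 0 ≤ x ^ 2 / 2)]
    gcongr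
    exact abs_le.2 ⟨(neg_pi_div_two_lt_arctan _).le, (arctan_lt_pi_div_two _).le⟩
  have hlim : Tendsto F atTop (𝓝 0) := by
    have hb : Tendsto (fun x : ℝ ↦ x ^ (-(α - 2))) atTop (𝓝 0) :=
      tendsto_rpow_neg_atTop (by linarith)
    refine squeeze_zero' ?_ ?_ hb
    all_goals
      filter_upwards [eventually_gt_atTop 0] with x hx
      have hxa := rpow_pos_of_pos hx (-α)
      have h0 : 0 ≤ arctan (x ^ (-α)) := arctan_nonneg.2 hxa.le
    · positivity
    · calc F x ≤ x ^ 2 * x ^ (-α) := by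
            have := arctan_le_self hxa.le
            simp only [hF]
            gcongr
            linarith [sq_nonneg x]
        _ = x ^ (-(α - 2)) := by
            rw [← rpow_two, ← rpow_add hx]
            congr 1
            ring
  have key := integral_Ioi_of_hasDerivAt_of_tendsto hcont
    (fun x hx ↦ hasDerivAt_sq_mul_arctan_rpow_neg α hx) (hF_int.sub hG_int) hlim
  rw [integral_sub hF_int hG_int, integral_const_mul,
    integral_rpow_div_one_add_rpow (by linarith) (by linarith),
    show π * ((α + 2) / (2 * α)) = π / α + π / 2 by field_simp; ring, sin_add_pi_div_two] at key
  have hF0 : F 0 = 0 := by simp [hF]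
  rw [hF0, sub_zero, sub_eq_zero] at key
  rw [key]
  have : cos (π / α) ≠ 0 := (cos_pos_of_mem_Ioo ⟨by linarith [div_pos pi_pos hα0, pi_pos],
    div_lt_div_of_pos_left pi_pos zero_lt_two hα⟩).ne'
  field_simp
  norm_num

theorem mul_arctan_mul_rpow_neg_eq {α a x : ℝ} (hα : 0 < α) (ha : 0 < a) (hx : 0 < x) :
    x * arctan (a * x ^ (-α)) =
      a ^ α⁻¹ * ((a ^ (-α⁻¹) * x) * arctan ((a ^ (-α⁻¹) * x) ^ (-α))) := by
  have h : (a ^ (-α⁻¹)) ^ (-α) = a := by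
    rw [← rpow_mul ha.le, neg_mul_neg, inv_mul_cancel₀ hα.ne', rpow_one]
  have := rpow_pos_of_pos ha α⁻¹
  rw [mul_rpow (by positivity) hx.le, h, rpow_neg ha.le]
  field_simp

theorem integrableOn_mul_arctan_mul_rpow_neg {α a : ℝ} (hα : 2 < α) (ha : 0 ≤ a) :
    IntegrableOn (fun x : ℝ ↦ x * arctan (a * x ^ (-α))) (Ioi 0) := by
  rcases ha.eq_or_lt with rfl | ha
  · simp
  refine IntegrableOn.congr_fun (Integrable.const_mul ?_ _)
    (fun x hx ↦ (mul_arctan_mul_rpow_neg_eq (by linarith) ha hx).symm) measurableSet_Ioi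
  refine (integrableOn_Ioi_comp_mul_left_iff (fun x ↦ x * arctan (x ^ (-α))) 0
    (rpow_pos_of_pos ha (-α⁻¹))).2 ?_
  simpa using integrableOn_mul_arctan_rpow_neg hα

theorem integral_mul_arctan_mul_rpow_neg {α a : ℝ} (hα : 2 < α) (ha : 0 ≤ a) :
    ∫ x in Ioi (0 : ℝ), x * arctan (a * x ^ (-α)) = π / (4 * cos (π / α)) * a ^ (2 / α) := by
  have hα0 : 0 < α := by linarith
  rcases ha.eq_or_lt with rfl | ha
  · simp [zero_rpow (div_pos two_pos hα0).ne']
  rw [setIntegral_congr_fun measurableSet_Ioi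
    (fun x hx ↦ mul_arctan_mul_rpow_neg_eq hα0 ha hx), integral_const_mul,
    integral_comp_mul_left_Ioi (fun x ↦ x * arctan (x ^ (-α))) 0 (rpow_pos_of_pos ha (-α⁻¹)),
    mul_zero, integral_mul_arctan_rpow_neg hα, rpow_neg ha.le, inv_inv, smul_eq_mul, ← mul_assoc,
    ← rpow_add ha, mul_comm]
  congr 2
  ring

section PolarCoordinates

variable {E F : Type*} [NormedAddCommGroup E] [NormedSpace ℝ E] [Nontrivial E]
  [FiniteDimensional ℝ E] [MeasurableSpace E] [BorelSpace E]
  [NormedAddCommGroup F] [NormedSpace ℝ F]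

theorem integral_eq_integral_toSphere_prod_volumeIoiPow (μ : Measure E) [μ.IsAddHaarMeasure]
    (f : E → F) :
    ∫ x, f x ∂μ = ∫ p : sphere (0 : E) 1 × Ioi (0 : ℝ), f ((p.2 : ℝ) • (p.1 : E))
      ∂μ.toSphere.prod (.volumeIoiPow (Module.finrank ℝ E - 1)) :=
  calc
    ∫ x, f x ∂μ = ∫ x : ({(0)}ᶜ : Set E), f x ∂(μ.comap (↑)) := by
      rw [integral_subtype_comap (measurableSet_singleton _).compl f, restrict_compl_singleton]
    _ = _ := by
      rw [← μ.measurePreserving_homeomorphUnitSphereProd.integral_comp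
        (Homeomorph.measurableEmbedding _)]
      refine integral_congr_ae (.of_forall fun x ↦ ?_)
      have hx : ‖(x : E)‖ ≠ 0 := norm_ne_zero_iff.2 x.2
      simp [smul_smul, mul_inv_cancel₀ hx]

theorem integral_volumeIoiPow (n : ℕ) (f : ℝ → F) :
    ∫ x : Ioi (0 : ℝ), f x ∂.volumeIoiPow n = ∫ y in Ioi (0 : ℝ), y ^ n • f y := by
  simp only [Measure.volumeIoiPow, ENNReal.ofReal]
  rw [integral_withDensity_eq_integral_smul,
    integral_subtype_comap measurableSet_Ioi fun a ↦ Real.toNNReal (a ^ n) • f a,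
    setIntegral_congr_fun measurableSet_Ioi fun x hx ↦ ?_]
  · rw [NNReal.smul_def, Real.coe_toNNReal _ (pow_nonneg (le_of_lt hx) _)]
  · exact (measurable_subtype_coe.pow_const _).real_toNNReal

theorem integrable_volumeIoiPow_iff (n : ℕ) {f : ℝ → F} :
    Integrable (fun x : Ioi (0 : ℝ) ↦ f x) (.volumeIoiPow n) ↔
      IntegrableOn (fun y ↦ y ^ n • f y) (Ioi 0) := by
  rw [integrableOn_iff_comap_subtypeVal measurableSet_Ioi, Function.comp_def,
    Measure.volumeIoiPow, integrable_withDensity_iff_integrable_smul', integrable_congr]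
  · refine .of_forall ?_
    rintro ⟨x, hx : 0 < x⟩
    simp (disch := positivity) [ENNReal.toReal_ofReal]
  · fun_prop
  · simp

end PolarCoordinates

theorem one_add_sq_rpow_le {α t : ℝ} (hα : 0 ≤ α) (ht : 0 < t) :
    (1 + t ^ 2) ^ (-α / 2) ≤ t ^ (-α) := by
  have h : t ^ (-α) = (t ^ 2) ^ (-α / 2) := by
    rw [← rpow_two, ← rpow_mul ht.le]
    congr 1
    ring
  rw [h]
  exact rpow_le_rpow_of_nonpos (by positivity) (by linarith) (by linarith)

theorem integrable_arctan_mul_rpow_neg_prod {α a : ℝ} (hα : 2 < α) (ha : 0 ≤ a) :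
    Integrable (fun p : sphere (0 : Plane) 1 × Ioi (0 : ℝ) ↦ arctan (a * (p.2 : ℝ) ^ (-α)))
      (circleMeasure.prod (.volumeIoiPow 1)) := by
  have : IsFiniteMeasure circleMeasure := by unfold circleMeasure; infer_instance
  refine Integrable.comp_snd (f := fun x : Ioi (0 : ℝ) ↦ arctan (a * (x : ℝ) ^ (-α))) ?_ _
  refine (integrable_volumeIoiPow_iff 1 (f := fun x : ℝ ↦ arctan (a * x ^ (-α)))).2 ?_
  simpa using integrableOn_mul_arctan_mul_rpow_neg hα ha

theorem integral_arctan_mul_rpow_neg_prod {α : ℝ} (hα : 2 < α)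
    {u : sphere (0 : Plane) 1 → ℝ} (hu : Continuous u) (hu0 : ∀ θ, 0 ≤ u θ) :
    ∫ p : sphere (0 : Plane) 1 × Ioi (0 : ℝ), arctan (u p.1 * (p.2 : ℝ) ^ (-α))
      ∂circleMeasure.prod (.volumeIoiPow 1) =
      π / (4 * cos (π / α)) * ∫ θ, u θ ^ (2 / α) ∂circleMeasure := by
  have : IsFiniteMeasure circleMeasure := by unfold circleMeasure; infer_instance
  obtain ⟨M, hM⟩ := (isCompact_range hu).bddAbove
  have hF_int : Integrable (fun p : sphere (0 : Plane) 1 × Ioi (0 : ℝ) ↦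
      arctan (u p.1 * (p.2 : ℝ) ^ (-α))) (circleMeasure.prod (.volumeIoiPow 1)) := by
    refine (integrable_arctan_mul_rpow_neg_prod hα (le_max_right M 0)).mono'
      (Measurable.aestronglyMeasurable (by fun_prop)) (.of_forall fun p ↦ ?_)
    have hp : 0 ≤ (p.2 : ℝ) ^ (-α) := rpow_nonneg (le_of_lt p.2.2) _
    rw [norm_of_nonneg (arctan_nonneg.2 (mul_nonneg (hu0 _) hp)), arctan_le_arctan_iff]
    exact mul_le_mul_of_nonneg_right ((hM (mem_range_self _)).trans (le_max_left _ _)) hp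
  rw [integral_prod _ hF_int, ← integral_const_mul]
  congr 1 with θ
  rw [integral_volumeIoiPow 1 fun x : ℝ ↦ arctan (u θ * x ^ (-α)),
    ← integral_mul_arctan_mul_rpow_neg hα (hu0 θ)]
  simp

theorem rpow_mul_integral_arctan_eq {α r : ℝ} (hr : 0 < r) (U : Plane → ℝ) :
    r ^ (2 / α) * ∫ x : Plane, arctan (U x / r) =
      ∫ p : sphere (0 : Plane) 1 × Ioi (0 : ℝ),
        arctan (U ((r ^ (-α⁻¹) * (p.2 : ℝ)) • (p.1 : Plane)) / r)
        ∂circleMeasure.prod (.volumeIoiPow 1) := by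
  have h := Measure.integral_comp_inv_smul_of_nonneg (volume : Measure Plane)
    (fun x ↦ arctan (U x / r)) (rpow_nonneg hr.le α⁻¹)
  have h2 : (r ^ α⁻¹) ^ Module.finrank ℝ Plane = r ^ (2 / α) := by
    rw [finrank_euclideanSpace_fin, ← rpow_natCast, ← rpow_mul hr.le]
    congr 1
    push_cast
    ring
  rw [h2, smul_eq_mul] at h
  rw [← h, integral_eq_integral_toSphere_prod_volumeIoiPow, finrank_euclideanSpace_fin,
    rpow_neg hr.le]
  simp only [smul_smul]
  rfl

theorem rpow_neg_inv_mul_rpow_neg {α r x : ℝ} (hα : α ≠ 0) (hr : 0 < r) (hx : 0 < x) :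
    (r ^ (-α⁻¹) * x) ^ (-α) = r * x ^ (-α) := by
  rw [mul_rpow (by positivity) hx.le, ← rpow_mul hr.le, neg_mul_neg, inv_mul_cancel₀ hα, rpow_one]

end AsymptoticHelpers

/-- For `α > 2` and `U(x) = u₀(x/‖x‖) ‖x‖^{-α} (1 + o(1))` with
`0 ≤ U(x) ≤ C (1+‖x‖²)^{-α/2}`, one has
`r^{2/α} ∫_{ℝ²} arctan(U(x)/r) dx → (π/(4 cos(π/α))) ∫_{S¹} u₀^{2/α} dσ` as `r ↓ 0`. -/
theorem trace_arctan_asymptotics (α C : ℝ) (hα : 2 < α) (hC : 0 < C)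
    (u₀ : sphere (0 : Plane) 1 → ℝ) (hu₀c : Continuous u₀) (hu₀ : ∀ θ, 0 ≤ u₀ θ)
    (U : Plane → ℝ) (hUm : Measurable U)
    (hU0 : ∀ x, 0 ≤ U x) (hUb : ∀ x, U x ≤ C * (1 + ‖x‖ ^ 2) ^ (-α / 2))
    (ε : Plane → ℝ) (hε : Tendsto ε (Filter.comap (fun x : Plane => ‖x‖) atTop) (𝓝 0))
    (hUasym : ∀ x : Plane, x ≠ 0 → ∀ y : sphere (0 : Plane) 1,
      (y : Plane) = ‖x‖⁻¹ • x → U x = u₀ y * ‖x‖ ^ (-α) * (1 + ε x)) :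
    Tendsto (fun r : ℝ => r ^ (2 / α) * ∫ x : Plane, Real.arctan (U x / r))
      (𝓝[>] 0)
      (𝓝 ((Real.pi / (4 * Real.cos (Real.pi / α))) *
        ∫ θ, u₀ θ ^ (2 / α) ∂circleMeasure)) := by
  have hα0 : 0 < α := by linarith
  have norm_eq (θ : sphere (0 : Plane) 1) {t : ℝ} (ht : 0 < t) : ‖t • (θ : Plane)‖ = t := by
    rw [norm_smul, norm_eq_of_mem_sphere, mul_one, Real.norm_of_nonneg ht.le]
  have U_le (θ : sphere (0 : Plane) 1) {t : ℝ} (ht : 0 < t) :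
      U (t • (θ : Plane)) ≤ C * t ^ (-α) := by
    refine (hUb _).trans ?_
    rw [norm_eq θ ht]
    exact mul_le_mul_of_nonneg_left (one_add_sq_rpow_le hα0.le ht) hC.le
  have U_eq (θ : sphere (0 : Plane) 1) {t : ℝ} (ht : 0 < t) :
      U (t • (θ : Plane)) = u₀ θ * t ^ (-α) * (1 + ε (t • (θ : Plane))) := by
    have h := hUasym (t • (θ : Plane)) (norm_pos_iff.1 (by rwa [norm_eq θ ht])) θ
    rw [norm_eq θ ht] at h
    exact h (by rw [smul_smul, inv_mul_cancel₀ ht.ne', one_smul])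
  rw [← integral_arctan_mul_rpow_neg_prod hα hu₀c hu₀]
  refine Tendsto.congr' (f₁ := fun r : ℝ ↦ ∫ p : sphere (0 : Plane) 1 × Set.Ioi (0 : ℝ),
    Real.arctan (U ((r ^ (-α⁻¹) * (p.2 : ℝ)) • (p.1 : Plane)) / r)
      ∂circleMeasure.prod (.volumeIoiPow 1)) ?_ ?_
  · filter_upwards [self_mem_nhdsWithin] with r hr
    exact (rpow_mul_integral_arctan_eq hr U).symm
  refine tendsto_integral_filter_of_dominated_convergence _ ?_ ?_
    (integrable_arctan_mul_rpow_neg_prod hα hC.le) ?_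
  · exact .of_forall fun r ↦ Measurable.aestronglyMeasurable (by fun_prop)
  · filter_upwards [self_mem_nhdsWithin] with r (hr : 0 < r)
    refine .of_forall fun ⟨θ, x, hx⟩ ↦ ?_
    have hx : 0 < x := hx
    rw [Real.norm_of_nonneg (Real.arctan_nonneg.2 (div_nonneg (hU0 _) hr.le)),
      Real.arctan_le_arctan_iff, div_le_iff₀ hr]
    refine (U_le θ (by positivity)).trans_eq ?_
    rw [rpow_neg_inv_mul_rpow_neg hα0.ne' hr hx]
    ring
  · refine .of_forall fun ⟨θ, x, hx⟩ ↦ ?_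
    have hx : 0 < x := hx
    have hscale : Tendsto (fun r : ℝ ↦ r ^ (-α⁻¹) * x) (𝓝[>] 0) atTop :=
      (tendsto_rpow_neg_nhdsGT_zero (by simpa)).atTop_mul_const hx
    have hε' : Tendsto (fun r : ℝ ↦ ε ((r ^ (-α⁻¹) * x) • (θ : Plane))) (𝓝[>] 0) (𝓝 0) := by
      refine hε.comp (tendsto_comap_iff.2 (hscale.congr' ?_))
      filter_upwards [self_mem_nhdsWithin] with r (hr : 0 < r)
      exact (norm_eq θ (by positivity)).symm
    refine (Real.continuous_arctan.tendsto _).comp (Tendsto.congr' (f₁ := fun r : ℝ ↦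
      u₀ θ * x ^ (-α) * (1 + ε ((r ^ (-α⁻¹) * x) • (θ : Plane)))) ?_ ?_)
    · filter_upwards [self_mem_nhdsWithin] with r (hr : 0 < r)
      rw [U_eq θ (by positivity), rpow_neg_inv_mul_rpow_neg hα0.ne' hr hx]
      field_simp
    · simpa using (hε'.const_add 1).const_mul (u₀ θ * x ^ (-α))
end

section
/- Let m > 3. For E > 0 define L_E : ℝ × ℝ → ℝ by L_E(x, y) = (1 + x²)^{−m/4} · sin(√E |x − y|) / (2√E) · (1 + y²)^{−m/4}, and L₀(x, y) = (1 + x²)^{−m/4} · (|x − y| / 2) · (1 + y²)^{−m/4}. Then for every E > 0, ∫_ℝ ∫_ℝ (L_E(x, y) − L₀(x, y))² dx dy < ∞, and lim_{E→0⁺} ∫_ℝ ∫_ℝ (L_E(x, y) − L₀(x, y))² dx dy = 0. (This is the kernel convergence establishing that Re T_<(E) converges in norm as E ↓ 0, the key analytic step in the proof of Proposition 5.4, hence n_±(s; Re T_<(E)) = O(1).) -/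
open MeasureTheory Filter
open scoped Topology

/-- The kernel `L_E(x,y) = ⟨x⟩^{−m/2} sin(√E|x−y|)/(2√E) ⟨y⟩^{−m/2}` for `E > 0`. -/
noncomputable def kerSinE (m E x y : ℝ) : ℝ :=
  (1 + x ^ 2) ^ (-m / 4) * (Real.sin (Real.sqrt E * |x - y|) / (2 * Real.sqrt E)) *
    (1 + y ^ 2) ^ (-m / 4)

/-- The limiting kernel `L₀(x,y) = ⟨x⟩^{−m/2} (|x−y|/2) ⟨y⟩^{−m/2}`. -/
noncomputable def kerSinZero (m x y : ℝ) : ℝ :=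
  (1 + x ^ 2) ^ (-m / 4) * (|x - y| / 2) * (1 + y ^ 2) ^ (-m / 4)

theorem abs_sin_mul_div_sub_le {s t : ℝ} (hs : 0 < s) (ht : 0 ≤ t) :
    |Real.sin (s * t) / (2 * s) - t / 2| ≤ t := by
  have h : |Real.sin (s * t) / (2 * s)| ≤ t / 2 := by
    rw [abs_div, abs_of_pos (by positivity : 0 < 2 * s), div_le_iff₀ (by positivity)]
    calc |Real.sin (s * t)| ≤ |s * t| := Real.abs_sin_le_abs
      _ = t / 2 * (2 * s) := by rw [abs_of_nonneg (by positivity)]; ring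
  rw [abs_le] at h ⊢
  constructor <;> linarith

theorem tendsto_sin_sqrt_mul_div (t : ℝ) :
    Tendsto (fun E : ℝ => Real.sin (√E * t) / (2 * √E)) (𝓝[>] 0) (𝓝 (t / 2)) := by
  have hderiv : HasDerivAt (fun s : ℝ => Real.sin (s * t)) t 0 := by
    simpa using ((hasDerivAt_id (0 : ℝ)).mul_const t).sin
  have hsqrt : Tendsto (fun E : ℝ => √E) (𝓝[>] 0) (𝓝[≠] 0) := by
    refine tendsto_nhdsWithin_iff.2 ⟨?_, ?_⟩
    · simpa using (Real.continuous_sqrt.tendsto 0).mono_left nhdsWithin_le_nhds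
    · filter_upwards [self_mem_nhdsWithin] with E hE
      exact (Real.sqrt_pos.2 hE).ne'
  refine ((hderiv.tendsto_slope_zero.comp hsqrt).div_const 2).congr fun E => ?_
  simp [div_eq_mul_inv]
  ring

theorem kerSinE_sub_kerSinZero (m E x y : ℝ) :
    kerSinE m E x y - kerSinZero m x y =
      (1 + x ^ 2) ^ (-m / 4) * (Real.sin (√E * |x - y|) / (2 * √E) - |x - y| / 2) *
        (1 + y ^ 2) ^ (-m / 4) := by
  unfold kerSinE kerSinZero
  ring

theorem rpow_neg_div_four_sq_mul (m x : ℝ) :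
    ((1 + x ^ 2) ^ (-m / 4)) ^ 2 * (1 + x ^ 2) = (1 + x ^ 2) ^ (-(m - 2) / 2) := by
  have hx : 0 < 1 + x ^ 2 := by positivity
  rw [← Real.rpow_mul_natCast hx.le, ← Real.rpow_add_one hx.ne']
  congr 1
  push_cast
  ring

theorem kerSinE_sub_kerSinZero_sq_le (m : ℝ) {E : ℝ} (hE : 0 < E) (x y : ℝ) :
    (kerSinE m E x y - kerSinZero m x y) ^ 2 ≤
      2 * ((1 + x ^ 2) ^ (-(m - 2) / 2) * (1 + y ^ 2) ^ (-(m - 2) / 2)) := by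
  have h := abs_sin_mul_div_sub_le (Real.sqrt_pos.2 hE) (abs_nonneg (x - y))
  have hsq : (Real.sin (√E * |x - y|) / (2 * √E) - |x - y| / 2) ^ 2 ≤
      2 * ((1 + x ^ 2) * (1 + y ^ 2)) := by
    calc _ ≤ |x - y| ^ 2 := sq_le_sq.2 (by rwa [abs_abs])
      _ = (x - y) ^ 2 := sq_abs _
      _ ≤ _ := by nlinarith [sq_nonneg (x + y), sq_nonneg (x * y)]
  rw [kerSinE_sub_kerSinZero, ← rpow_neg_div_four_sq_mul, ← rpow_neg_div_four_sq_mul,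
    mul_pow, mul_pow]
  calc _ ≤ ((1 + x ^ 2) ^ (-m / 4)) ^ 2 * (2 * ((1 + x ^ 2) * (1 + y ^ 2))) *
        ((1 + y ^ 2) ^ (-m / 4)) ^ 2 := by gcongr
    _ = _ := by ring

theorem integrable_kerSin_bound {m : ℝ} (hm : 3 < m) :
    Integrable (fun p : ℝ × ℝ =>
      2 * ((1 + p.1 ^ 2) ^ (-(m - 2) / 2) * (1 + p.2 ^ 2) ^ (-(m - 2) / 2))) := by
  have h : Integrable (fun x : ℝ => (1 + x ^ 2) ^ (-(m - 2) / 2)) := by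
    simpa using integrable_rpow_neg_one_add_norm_sq (E := ℝ) (μ := volume) (r := m - 2)
      (by simp; linarith)
  exact (h.mul_prod h).const_mul 2

theorem measurable_kerSinE_sub_kerSinZero_sq (m E : ℝ) :
    Measurable (fun p : ℝ × ℝ => (kerSinE m E p.1 p.2 - kerSinZero m p.1 p.2) ^ 2) := by
  unfold kerSinE kerSinZero
  fun_prop

/-- For `m > 3`: `L_E − L₀` is square integrable for every `E > 0`, and
`∬ (L_E − L₀)² → 0` as `E ↓ 0` (Hilbert–Schmidt convergence of the kernels of
`Re T_<(E)`). -/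
theorem kernel_sin_hs_convergence (m : ℝ) (hm : 3 < m) :
    (∀ E : ℝ, 0 < E →
      Integrable (fun p : ℝ × ℝ => (kerSinE m E p.1 p.2 - kerSinZero m p.1 p.2) ^ 2)) ∧
    Tendsto (fun E : ℝ => ∫ p : ℝ × ℝ, (kerSinE m E p.1 p.2 - kerSinZero m p.1 p.2) ^ 2)
      (𝓝[>] 0) (𝓝 0) := by
  have hbound : ∀ E : ℝ, 0 < E → ∀ᵐ p : ℝ × ℝ,
      ‖(kerSinE m E p.1 p.2 - kerSinZero m p.1 p.2) ^ 2‖ ≤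
        2 * ((1 + p.1 ^ 2) ^ (-(m - 2) / 2) * (1 + p.2 ^ 2) ^ (-(m - 2) / 2)) := by
    refine fun E hE => ae_of_all _ fun p => ?_
    rw [Real.norm_of_nonneg (sq_nonneg _)]
    exact kerSinE_sub_kerSinZero_sq_le m hE p.1 p.2
  have hmeas (E : ℝ) := (measurable_kerSinE_sub_kerSinZero_sq m E).aestronglyMeasurable
    (μ := volume)
  refine ⟨fun E hE => (integrable_kerSin_bound hm).mono' (hmeas E) (hbound E hE), ?_⟩
  suffices h : Tendsto (fun E : ℝ => ∫ p : ℝ × ℝ, (kerSinE m E p.1 p.2 - kerSinZero m p.1 p.2) ^ 2)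
      (𝓝[>] 0) (𝓝 (∫ _ : ℝ × ℝ, (0 : ℝ))) by simpa using h
  refine tendsto_integral_filter_of_dominated_convergence _ (.of_forall hmeas)
    (by filter_upwards [self_mem_nhdsWithin] with E hE using hbound E hE)
    (integrable_kerSin_bound hm) (ae_of_all _ fun p => ?_)
  have h := (((((tendsto_sin_sqrt_mul_div |p.1 - p.2|).sub_const (|p.1 - p.2| / 2)).const_mul
    ((1 + p.1 ^ 2) ^ (-m / 4))).mul_const ((1 + p.2 ^ 2) ^ (-m / 4))).pow 2)
  simpa [kerSinE_sub_kerSinZero] using h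
end
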